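/- Give the polynomial ring ℚ[c1, c2, c3, d1, …, d6] the grading in which c_i has degree i and each d_j has degree 1. For an unordered triple {a, b, c} ⊂ {1, …, 6}, let φ_{a|b|c} : ℚ[c1, c2, c3, d1, …, d6] → ℚ[α, β, γ, δ, η, θ] be the ℚ-algebra homomorphism with c1 ↦ α + β + γ, c2 ↦ αβ + αγ + βγ, c3 ↦ αβγ, d_a ↦ α, d_b ↦ β, d_c ↦ γ, and the remaining three variables d_j (taken in increasing order of the index j) mapped to δ, η, θ respectively. Let φ_{124|356} : ℚ[c1, c2, c3, d1, …, d6] → ℚ[α, β, γ] be the ℚ-algebra homomorphism with c1 ↦ α + β + γ, c2 ↦ αβ + αγ + βγ, c3 ↦ αβγ, d1 ↦ α, d2 ↦ α, d4 ↦ α, d3 ↦ β, d5 ↦ β, d6 ↦ β. Then the ℚ-vector space of homogeneous degree-4 polynomials lying in the intersection of the kernels of the five maps φ_{1|2|6}, φ_{1|3|5}, φ_{2|3|4}, φ_{4|5|6}, and φ_{124|356} has dimension 1. -/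

import Mathlib

open MvPolynomial

/-- The grading weights on `ℚ[c₁,c₂,c₃,d₁,…,d₆]` (variables `0,1,2` are `c₁,c₂,c₃`
of degrees `1,2,3`; variables `3,…,8` are `d₁,…,d₆` of degree `1`). -/
def wt : Fin 9 → ℕ := ![1, 2, 3, 1, 1, 1, 1, 1, 1]

/-- The restriction homomorphism `φ_{1|2|6}` to `ℚ[α,β,γ,δ,η,θ]`:
`c₁ ↦ α+β+γ`, `c₂ ↦ αβ+αγ+βγ`, `c₃ ↦ αβγ`, `d₁ ↦ α`, `d₂ ↦ β`, `d₆ ↦ γ`,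
and `d₃, d₄, d₅ ↦ δ, η, θ`. -/
noncomputable def φ126 : MvPolynomial (Fin 9) ℚ →ₐ[ℚ] MvPolynomial (Fin 6) ℚ :=
  aeval ![X 0 + X 1 + X 2, X 0 * X 1 + X 0 * X 2 + X 1 * X 2, X 0 * X 1 * X 2,
    X 0, X 1, X 3, X 4, X 5, X 2]

/-- The restriction homomorphism `φ_{1|3|5}`: `d₁ ↦ α`, `d₃ ↦ β`, `d₅ ↦ γ`,
and `d₂, d₄, d₆ ↦ δ, η, θ`. -/
noncomputable def φ135 : MvPolynomial (Fin 9) ℚ →ₐ[ℚ] MvPolynomial (Fin 6) ℚ :=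
  aeval ![X 0 + X 1 + X 2, X 0 * X 1 + X 0 * X 2 + X 1 * X 2, X 0 * X 1 * X 2,
    X 0, X 3, X 1, X 4, X 2, X 5]

/-- The restriction homomorphism `φ_{2|3|4}`: `d₂ ↦ α`, `d₃ ↦ β`, `d₄ ↦ γ`,
and `d₁, d₅, d₆ ↦ δ, η, θ`. -/
noncomputable def φ234 : MvPolynomial (Fin 9) ℚ →ₐ[ℚ] MvPolynomial (Fin 6) ℚ :=
  aeval ![X 0 + X 1 + X 2, X 0 * X 1 + X 0 * X 2 + X 1 * X 2, X 0 * X 1 * X 2,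
    X 3, X 0, X 1, X 2, X 4, X 5]

/-- The restriction homomorphism `φ_{4|5|6}`: `d₄ ↦ α`, `d₅ ↦ β`, `d₆ ↦ γ`,
and `d₁, d₂, d₃ ↦ δ, η, θ`. -/
noncomputable def φ456 : MvPolynomial (Fin 9) ℚ →ₐ[ℚ] MvPolynomial (Fin 6) ℚ :=
  aeval ![X 0 + X 1 + X 2, X 0 * X 1 + X 0 * X 2 + X 1 * X 2, X 0 * X 1 * X 2,
    X 3, X 4, X 5, X 0, X 1, X 2]

/-- The restriction homomorphism `φ_{124|356}` to `ℚ[α,β,γ]`: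
`c₁ ↦ α+β+γ`, `c₂ ↦ αβ+αγ+βγ`, `c₃ ↦ αβγ`, `d₁, d₂, d₄ ↦ α`, `d₃, d₅, d₆ ↦ β`. -/
noncomputable def φ124_356 : MvPolynomial (Fin 9) ℚ →ₐ[ℚ] MvPolynomial (Fin 3) ℚ :=
  aeval ![X 0 + X 1 + X 2, X 0 * X 1 + X 0 * X 2 + X 1 * X 2, X 0 * X 1 * X 2,
    X 0, X 0, X 1, X 0, X 1, X 1]

/-- The ratio of total Chern classes `∏ (1 + dⱼ) / (1 + c₁ + c₂ + c₃)` in degree 4, corrected by the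
product of the four forms `c₁ - d_a - d_b - d_c` so that it vanishes under `φ124_356`. -/
noncomputable def menelausClass : MvPolynomial (Fin 9) ℚ :=
  let e₁ := X 3 + X 4 + X 8
  let e₂ := X 3 * X 4 + X 3 * X 8 + X 4 * X 8
  let e₃ := X 3 * X 4 * X 8
  let f₁ := X 5 + X 6 + X 7
  let f₂ := X 5 * X 6 + X 5 * X 7 + X 6 * X 7
  let f₃ := X 5 * X 6 * X 7
  X 1 ^ 2 + X 2 * (2 • X 0 - (e₁ + f₁))
    + X 1 * (2 • (X 0 * (e₁ + f₁)) - 3 • (X 0 * X 0) - (e₂ + e₁ * f₁ + f₂))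
    + ((e₃ * f₁ + e₂ * f₂ + e₁ * f₃) - X 0 * (e₃ + e₂ * f₁ + e₁ * f₂ + f₃)
      + X 0 ^ 2 * (e₂ + e₁ * f₁ + f₂) - X 0 ^ 3 * (e₁ + f₁) + X 0 ^ 4)
    - (X 0 - X 3 - X 4 - X 8) * (X 0 - X 3 - X 5 - X 7) * (X 0 - X 4 - X 5 - X 6)
      * (X 0 - X 6 - X 7 - X 8)

lemma isWeightedHomogeneous_menelausClass :
    menelausClass ∈ weightedHomogeneousSubmodule ℚ wt 4 := by
  have c₁ : X 0 ∈ weightedHomogeneousSubmodule ℚ wt 1 := isWeightedHomogeneous_X ℚ wt 0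
  have c₂ : X 1 ∈ weightedHomogeneousSubmodule ℚ wt 2 := isWeightedHomogeneous_X ℚ wt 1
  have c₃ : X 2 ∈ weightedHomogeneousSubmodule ℚ wt 3 := isWeightedHomogeneous_X ℚ wt 2
  have d₁ : X 3 ∈ weightedHomogeneousSubmodule ℚ wt 1 := isWeightedHomogeneous_X ℚ wt 3
  have d₂ : X 4 ∈ weightedHomogeneousSubmodule ℚ wt 1 := isWeightedHomogeneous_X ℚ wt 4
  have d₃ : X 5 ∈ weightedHomogeneousSubmodule ℚ wt 1 := isWeightedHomogeneous_X ℚ wt 5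
  have d₄ : X 6 ∈ weightedHomogeneousSubmodule ℚ wt 1 := isWeightedHomogeneous_X ℚ wt 6
  have d₅ : X 7 ∈ weightedHomogeneousSubmodule ℚ wt 1 := isWeightedHomogeneous_X ℚ wt 7
  have d₆ : X 8 ∈ weightedHomogeneousSubmodule ℚ wt 1 := isWeightedHomogeneous_X ℚ wt 8
  have mul {m n : ℕ} {p q : MvPolynomial (Fin 9) ℚ}
      (hp : p ∈ weightedHomogeneousSubmodule ℚ wt m)
      (hq : q ∈ weightedHomogeneousSubmodule ℚ wt n) :
      p * q ∈ weightedHomogeneousSubmodule ℚ wt (m + n) := IsWeightedHomogeneous.mul hp hq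
  have pow {m : ℕ} {p : MvPolynomial (Fin 9) ℚ}
      (hp : p ∈ weightedHomogeneousSubmodule ℚ wt m) (n : ℕ) :
      p ^ n ∈ weightedHomogeneousSubmodule ℚ wt (n * m) := IsWeightedHomogeneous.pow hp n
  have e₁ := add_mem (add_mem d₁ d₂) d₆
  have e₂ := add_mem (add_mem (mul d₁ d₂) (mul d₁ d₆)) (mul d₂ d₆)
  have e₃ := mul (mul d₁ d₂) d₆
  have f₁ := add_mem (add_mem d₃ d₄) d₅
  have f₂ := add_mem (add_mem (mul d₃ d₄) (mul d₃ d₅)) (mul d₄ d₅)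
  have f₃ := mul (mul d₃ d₄) d₅
  have g₁ := add_mem e₁ f₁
  have g₂ := add_mem (add_mem e₂ (mul e₁ f₁)) f₂
  have e₁f₂ := mul e₁ f₂
  have g₃ := add_mem (add_mem (add_mem e₃ (mul e₂ f₁)) e₁f₂) f₃
  have e₂f₂ := mul e₂ f₂
  have e₁f₃ := mul e₁ f₃
  have g₄ := add_mem (add_mem (mul e₃ f₁) e₂f₂) e₁f₃
  have h₁ := sub_mem (Submodule.smul_of_tower_mem _ 2 c₁) g₁
  have h₂ := sub_mem (sub_mem (Submodule.smul_of_tower_mem _ 2 (mul c₁ g₁))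
    (Submodule.smul_of_tower_mem _ 3 (mul c₁ c₁))) g₂
  have c₁g₃ := mul c₁ g₃
  have c₁g₂ := mul (pow c₁ 2) g₂
  have c₁g₁ := mul (pow c₁ 3) g₁
  have k := add_mem (sub_mem (add_mem (sub_mem g₄ c₁g₃) c₁g₂) c₁g₁) (pow c₁ 4)
  have l := mul (mul (mul (sub_mem (sub_mem (sub_mem c₁ d₁) d₂) d₆)
    (sub_mem (sub_mem (sub_mem c₁ d₁) d₃) d₅)) (sub_mem (sub_mem (sub_mem c₁ d₂) d₃) d₄))
    (sub_mem (sub_mem (sub_mem c₁ d₄) d₅) d₆)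
  have c₃h₁ := mul c₃ h₁
  have c₂h₂ := mul c₂ h₂
  exact sub_mem (add_mem (add_mem (add_mem (pow c₂ 2) c₃h₁) c₂h₂) k) l

lemma φ126_menelausClass : φ126 menelausClass = 0 := by
  simp [φ126, menelausClass, map_ofNat]; ring

lemma φ135_menelausClass : φ135 menelausClass = 0 := by
  simp [φ135, menelausClass, map_ofNat]; ring

lemma φ234_menelausClass : φ234 menelausClass = 0 := by
  simp [φ234, menelausClass, map_ofNat]; ring

lemma φ456_menelausClass : φ456 menelausClass = 0 := by
  simp [φ456, menelausClass, map_ofNat]; ring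

lemma φ124_356_menelausClass : φ124_356 menelausClass = 0 := by
  simp [φ124_356, menelausClass, map_ofNat]; ring

lemma eval_single_one_eq_coeff {F : MvPolynomial (Fin 9) ℚ}
    (hF : F ∈ weightedHomogeneousSubmodule ℚ wt 4) :
    eval (Pi.single 1 1) F = coeff (Finsupp.single 1 2) F := by
  rw [eval_eq', Finset.sum_eq_single (Finsupp.single 1 2)]
  · simp [Fin.prod_univ_succ]
  · intro m hm hne
    obtain ⟨i, hi, hmi⟩ : ∃ i ≠ 1, m i ≠ 0 := by
      by_contra! h
      have hm1 : m = Finsupp.single 1 (m 1) := by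
        ext i
        by_cases hi : i = 1
        · simp [hi]
        · simp [h i hi, Ne.symm hi]
      have hw := hF (mem_support_iff.1 hm)
      rw [hm1, Finsupp.weight_single] at hw
      have : m 1 = 2 := by simp [wt] at hw; omega
      exact hne (this ▸ hm1)
    exact mul_eq_zero_of_right _ (Finset.prod_eq_zero (Finset.mem_univ i) (by simp [hi, hmi]))
  · intro h
    simp [notMem_support_iff.1 h]

lemma coeff_menelausClass : coeff (Finsupp.single 1 2) menelausClass = 1 := by
  rw [← eval_single_one_eq_coeff isWeightedHomogeneous_menelausClass]
  simp [menelausClass]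

section Coordinates

variable {T : Type*} [CommRing T]

/-- For `i ≠ j`, the index of the coordinate shared by the edge `{i, j}` of `K₄` and the
opposite edge. -/
def matching : Fin 4 → Fin 4 → Fin 7 :=
  ![![0, 4, 5, 6], ![4, 0, 6, 5], ![5, 6, 0, 4], ![6, 5, 4, 0]]

lemma matching_comm (i j : Fin 4) : matching i j = matching j i := by decide +revert

lemma matching_eq_opposite {i j k l : Fin 4} (hij : i ≠ j) (hik : i ≠ k) (hil : i ≠ l)
    (hjk : j ≠ k) (hjl : j ≠ l) (hkl : k ≠ l) : matching i j = matching k l := by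
  have h : ∀ i j k l : Fin 4, [i, j, k, l].Nodup → matching i j = matching k l := by decide
  exact h i j k l (by simp [*])

lemma matching_ne {i j k : Fin 4} (hij : i ≠ j) (hik : i ≠ k) (hjk : j ≠ k) :
    matching i j ≠ matching i k := by
  decide +revert

/-- The coordinates indexed by the four lines. -/
def lineIdx : Fin 4 → Fin 7 := ![0, 1, 2, 3]

/-- The vectors of the Menelaus configuration are the intersections of pairs of four lines. In
coordinates `t` whose first four entries are (up to scale) the forms `c₁ - d_a - d_b - d_c`
of the lines, this is the variable `dₘ` of the intersection of the lines `i` and `j`. -/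
def edge (t : Fin 7 → T) (i j : Fin 4) : T :=
  t (matching i j) + (t 0 + t 1 + t 2 + t 3) - 2 * t (lineIdx i)
    - 2 * t (lineIdx j)

lemma edge_comm (t : Fin 7 → T) (i j : Fin 4) : edge t i j = edge t j i := by
  simp only [edge, matching_comm i j]
  ring

/-- The degree 1 variables `c₁, d₁, …, d₆` in the coordinates `t`. -/
def linearVars (t : Fin 7 → T) : Fin 7 → T :=
  ![t 0 + t 1 + t 2 + t 3 + t 4 + t 5 + t 6,
    edge t 0 1, edge t 0 2, edge t 1 2, edge t 2 3, edge t 1 3, edge t 0 3]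

/-- The positions of `c₁, d₁, …, d₆` among the nine variables. -/
def linearIdx : Fin 7 → Fin 9 := ![0, 3, 4, 5, 6, 7, 8]

/-- All nine variables in the coordinates `t` and the values of `c₂` and `c₃`. -/
def allVars (t : Fin 7 → T) (c₂ c₃ : T) : Fin 9 → T :=
  ![t 0 + t 1 + t 2 + t 3 + t 4 + t 5 + t 6, c₂, c₃,
    edge t 0 1, edge t 0 2, edge t 1 2, edge t 2 3, edge t 1 3, edge t 0 3]

end Coordinates

/-- The coordinates inverting `linearVars`, as polynomials in the nine variables. -/
noncomputable def fromCoords : MvPolynomial (Fin 7) ℚ →ₐ[ℚ] MvPolynomial (Fin 9) ℚ :=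
  aeval ![C (1 / 4) * (X 0 - X 3 - X 4 - X 8), C (1 / 4) * (X 0 - X 3 - X 5 - X 7),
    C (1 / 4) * (X 0 - X 4 - X 5 - X 6), C (1 / 4) * (X 0 - X 6 - X 7 - X 8),
    C (1 / 2) * (X 3 + X 6), C (1 / 2) * (X 4 + X 7), C (1 / 2) * (X 5 + X 8)]

lemma fromCoords_linearVars (k : Fin 7) : fromCoords (linearVars X k) = X (linearIdx k) := by
  have h4 : (C (1 / 4) : MvPolynomial (Fin 9) ℚ) * 4 = 1 := by
    rw [show (4 : MvPolynomial (Fin 9) ℚ) = C 4 from rfl, ← C_mul]; norm_num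
  have h2 : (C (1 / 2) : MvPolynomial (Fin 9) ℚ) = C (1 / 4) * 2 := by
    rw [show (2 : MvPolynomial (Fin 9) ℚ) = C 2 from rfl, ← C_mul]; norm_num
  rw [fromCoords, h2]
  generalize (C (1 / 4) : MvPolynomial (Fin 9) ℚ) = q at h4
  fin_cases k <;> simp [linearVars, linearIdx, edge, matching, lineIdx, map_ofNat]
  exacts [by linear_combination X 0 * h4, by linear_combination X 3 * h4,
    by linear_combination X 4 * h4, by linear_combination X 5 * h4,
    by linear_combination X 6 * h4, by linear_combination X 7 * h4,
    by linear_combination X 8 * h4]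

lemma aeval_allVars_fromCoords {T : Type*} [CommRing T] [Algebra ℚ T] (t : Fin 7 → T) (c₂ c₃ : T)
    (p : MvPolynomial (Fin 7) ℚ) : aeval (allVars t c₂ c₃) (fromCoords p) = aeval t p := by
  have h4 : algebraMap ℚ T (1 / 4) * 4 = 1 := by
    rw [← map_ofNat (algebraMap ℚ T), ← map_mul]; norm_num
  have h2 : algebraMap ℚ T (1 / 2) = algebraMap ℚ T (1 / 4) * 2 := by
    rw [← map_ofNat (algebraMap ℚ T), ← map_mul]; norm_num
  suffices (aeval (allVars t c₂ c₃)).comp fromCoords = aeval t from DFunLike.congr_fun this p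
  ext k
  rw [AlgHom.comp_apply, fromCoords, aeval_X, aeval_X]
  fin_cases k <;>
    simp only [allVars, edge, matching, lineIdx, Fin.reduceFinMk, Fin.isValue, Matrix.cons_val,
      map_mul, map_sub, map_add, aeval_X, algHom_C, Fin.zero_eta, Fin.mk_one, h2] <;>
    generalize algebraMap ℚ T (1 / 4) = q at h4
  exacts [by linear_combination t 0 * h4, by linear_combination t 1 * h4,
    by linear_combination t 2 * h4, by linear_combination t 3 * h4,
    by linear_combination t 4 * h4, by linear_combination t 5 * h4,
    by linear_combination t 6 * h4]

section Restriction

variable {T : Type*} [CommRing T] [Algebra ℚ T] {x : Fin 9 → T} {F : MvPolynomial (Fin 9) ℚ}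

lemma aeval_eq_zero_of_φ126 (h : φ126 F = 0) (h₁ : x 0 = x 3 + x 4 + x 8)
    (h₂ : x 1 = x 3 * x 4 + x 3 * x 8 + x 4 * x 8) (h₃ : x 2 = x 3 * x 4 * x 8) :
    aeval x F = 0 := by
  have : aeval x = (aeval ![x 3, x 4, x 8, x 5, x 6, x 7]).comp φ126 := by
    ext k; fin_cases k <;> simp [φ126, h₁, h₂, h₃]
  simp [this, h]

lemma aeval_eq_zero_of_φ135 (h : φ135 F = 0) (h₁ : x 0 = x 3 + x 5 + x 7)
    (h₂ : x 1 = x 3 * x 5 + x 3 * x 7 + x 5 * x 7) (h₃ : x 2 = x 3 * x 5 * x 7) :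
    aeval x F = 0 := by
  have : aeval x = (aeval ![x 3, x 5, x 7, x 4, x 6, x 8]).comp φ135 := by
    ext k; fin_cases k <;> simp [φ135, h₁, h₂, h₃]
  simp [this, h]

lemma aeval_eq_zero_of_φ234 (h : φ234 F = 0) (h₁ : x 0 = x 4 + x 5 + x 6)
    (h₂ : x 1 = x 4 * x 5 + x 4 * x 6 + x 5 * x 6) (h₃ : x 2 = x 4 * x 5 * x 6) :
    aeval x F = 0 := by
  have : aeval x = (aeval ![x 4, x 5, x 6, x 3, x 7, x 8]).comp φ234 := by
    ext k; fin_cases k <;> simp [φ234, h₁, h₂, h₃]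
  simp [this, h]

lemma aeval_eq_zero_of_φ456 (h : φ456 F = 0) (h₁ : x 0 = x 6 + x 7 + x 8)
    (h₂ : x 1 = x 6 * x 7 + x 6 * x 8 + x 7 * x 8) (h₃ : x 2 = x 6 * x 7 * x 8) :
    aeval x F = 0 := by
  have : aeval x = (aeval ![x 6, x 7, x 8, x 3, x 4, x 5]).comp φ456 := by
    ext k; fin_cases k <;> simp [φ456, h₁, h₂, h₃]
  simp [this, h]

end Restriction

lemma aeval_eq_zero_of_φ124_356 {F : MvPolynomial (Fin 9) ℚ} (h : φ124_356 F = 0) :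
    aeval ![(1 : ℚ), 0, 0, 0, 0, 0, 0, 0, 0] F = 0 := by
  have : aeval ![(1 : ℚ), 0, 0, 0, 0, 0, 0, 0, 0] = (aeval ![(0 : ℚ), 0, 1]).comp φ124_356 := by
    ext k; fin_cases k <;> simp [φ124_356]
  simp [this, h]

/-- The expansion `c₃ L + c₂ Q + G` in the coordinates of `linearVars`. -/
noncomputable def expansion (L Q G : MvPolynomial (Fin 7) ℚ) : MvPolynomial (Fin 9) ℚ :=
  X 2 * fromCoords L + X 1 * fromCoords Q + fromCoords G

lemma isHomogeneous_linearVars (k : Fin 7) :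
    (linearVars (X : Fin 7 → MvPolynomial (Fin 7) ℚ) k).IsHomogeneous 1 := by
  have hX (i : Fin 7) : X i ∈ homogeneousSubmodule (Fin 7) ℚ 1 := isHomogeneous_X ℚ i
  have hedge (i j : Fin 4) :
      edge (X : Fin 7 → MvPolynomial (Fin 7) ℚ) i j ∈ homogeneousSubmodule (Fin 7) ℚ 1 := by
    simp only [edge, two_mul, ← two_nsmul]
    exact sub_mem (sub_mem (add_mem (hX _) (add_mem (add_mem (add_mem (hX _) (hX _)) (hX _))
      (hX _))) (Submodule.smul_of_tower_mem _ 2 (hX _))) (Submodule.smul_of_tower_mem _ 2 (hX _))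
  have hsum : linearVars X 0 ∈ homogeneousSubmodule (Fin 7) ℚ 1 :=
    add_mem (add_mem (add_mem (add_mem (add_mem (add_mem (hX _) (hX _)) (hX _)) (hX _)) (hX _))
      (hX _)) (hX _)
  fin_cases k
  exacts [hsum, hedge _ _, hedge _ _, hedge _ _, hedge _ _, hedge _ _, hedge _ _]

lemma exists_eq_expansion_monomial (m : Fin 9 →₀ ℕ) (a : ℚ) (hm : Finsupp.weight wt m = 4)
    (hm' : m ≠ Finsupp.single 1 2) :
    ∃ L Q G : MvPolynomial (Fin 7) ℚ, L.IsHomogeneous 1 ∧ Q.IsHomogeneous 2 ∧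
      G.IsHomogeneous 4 ∧ monomial m a = expansion L Q G := by
  have hsum : m 0 + m 1 * 2 + m 2 * 3 + m 3 + m 4 + m 5 + m 6 + m 7 + m 8 = 4 := by
    rw [← hm]
    simp [Finsupp.weight_apply, Finsupp.sum_fintype, Fin.sum_univ_succ, wt]
    ring
  set P : MvPolynomial (Fin 7) ℚ := C a * ∏ k, linearVars X k ^ m (linearIdx k) with hP
  have hPhom : P.IsHomogeneous (∑ k, m (linearIdx k)) := by
    have := (isHomogeneous_C (Fin 7) a).mul (IsHomogeneous.prod Finset.univ
      (fun k => linearVars (X : Fin 7 → MvPolynomial (Fin 7) ℚ) k ^ m (linearIdx k)) _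
      fun k _ => (isHomogeneous_linearVars k).pow (m (linearIdx k)))
    simpa using this
  have hmon : monomial m a = X 1 ^ m 1 * X 2 ^ m 2 * fromCoords P := by
    rw [monomial_eq, Finsupp.prod_fintype _ _ (by simp), hP, map_mul, map_prod]
    simp [map_pow, fromCoords_linearVars, Fin.prod_univ_succ, linearIdx]
    ring
  have hdeg : ∑ k, m (linearIdx k) + m 1 * 2 + m 2 * 3 = 4 := by
    simp [Fin.sum_univ_succ, linearIdx]
    omega
  have hzero (n : ℕ) := isHomogeneous_zero (Fin 7) ℚ n
  have h1 : m 1 = 0 ∨ m 1 = 1 ∨ m 1 = 2 := by omega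
  have h2 : m 2 = 0 ∨ m 2 = 1 := by omega
  rcases h1 with h1 | h1 | h1 <;> rcases h2 with h2 | h2
  · refine ⟨0, 0, P, hzero 1, hzero 2, ?_, by simp [expansion, hmon, h1, h2]⟩
    convert hPhom using 1; omega
  · refine ⟨P, 0, 0, ?_, hzero 2, hzero 4, by simp [expansion, hmon, h1, h2]⟩
    convert hPhom using 1; omega
  · refine ⟨0, P, 0, hzero 1, ?_, hzero 4, by simp [expansion, hmon, h1, h2]⟩
    convert hPhom using 1; omega
  · omega
  · refine absurd (Finsupp.ext fun k => ?_) hm'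
    fin_cases k <;> simp <;> omega
  · omega

lemma exists_eq_expansion {F : MvPolynomial (Fin 9) ℚ}
    (hF : F ∈ weightedHomogeneousSubmodule ℚ wt 4) (hcoeff : coeff (Finsupp.single 1 2) F = 0) :
    ∃ L Q G : MvPolynomial (Fin 7) ℚ, L.IsHomogeneous 1 ∧ Q.IsHomogeneous 2 ∧
      G.IsHomogeneous 4 ∧ F = expansion L Q G := by
  rw [F.as_sum]
  refine Finset.sum_induction _ (fun F => ∃ L Q G : MvPolynomial (Fin 7) ℚ, L.IsHomogeneous 1 ∧
    Q.IsHomogeneous 2 ∧ G.IsHomogeneous 4 ∧ F = expansion L Q G) ?_ ?_ ?_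
  · rintro _ _ ⟨L, Q, G, hL, hQ, hG, rfl⟩ ⟨L', Q', G', hL', hQ', hG', rfl⟩
    refine ⟨_, _, _, hL.add hL', hQ.add hQ', hG.add hG', ?_⟩
    simp only [expansion, map_add]
    ring
  · exact ⟨0, 0, 0, isHomogeneous_zero _ _ _, isHomogeneous_zero _ _ _, isHomogeneous_zero _ _ _,
      by simp [expansion]⟩
  · intro m hm
    rw [mem_support_iff] at hm
    exact exists_eq_expansion_monomial m _ (hF hm) fun h => hm (h ▸ hcoeff)

/-- The point at which the coordinates in `S` vanish and the others are generic. -/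
noncomputable def coordPoint (S : Finset (Fin 7)) : Fin 7 → MvPolynomial (Fin 7) ℚ :=
  fun i => if i ∈ S then 0 else X i

lemma sum_pos_of_aeval_coordPoint_eq_zero {S : Finset (Fin 7)} {p : MvPolynomial (Fin 7) ℚ}
    (hp : aeval (coordPoint S) p = 0) {m : Fin 7 →₀ ℕ} (hm : m ∈ p.support) :
    0 < ∑ i ∈ S, m i := by
  let I : Ideal (MvPolynomial (Fin 7) ℚ) := Ideal.span (X '' (S : Set (Fin 7)))
  have hcomp : (Ideal.Quotient.mkₐ ℚ I).comp (aeval (coordPoint S)) =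
      Ideal.Quotient.mkₐ ℚ I := by
    ext i
    by_cases hi : i ∈ S
    · have : (X i : MvPolynomial (Fin 7) ℚ) ∈ I := Ideal.subset_span ⟨i, hi, rfl⟩
      simp [coordPoint, hi, Ideal.Quotient.eq_zero_iff_mem.2 this]
    · simp [coordPoint, hi]
  have hmem : p ∈ I := by
    have := DFunLike.congr_fun hcomp p
    simp only [AlgHom.comp_apply, hp, map_zero] at this
    exact Ideal.Quotient.eq_zero_iff_mem.1 this.symm
  obtain ⟨i, hi, hmi⟩ := mem_ideal_span_X_image.1 hmem m hm
  exact Finset.sum_pos_iff.2 ⟨i, hi, Nat.pos_of_ne_zero hmi⟩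

/-- The restriction of `c₃ L + c₂ Q + G` to the locus where `P(t) = (t - x)(t - a)(t - b)`. -/
lemma add_eq_zero_of_two_lines {T : Type*} [CommRing T] [IsDomain T] {x a b c e L Q G : T}
    (hsum : a + b = c + e) (hac : a ≠ c) (hae : a ≠ e)
    (h : x * a * b * L + (x * a + x * b + a * b) * Q + G = 0)
    (h' : x * c * e * L + (x * c + x * e + c * e) * Q + G = 0) : x * L + Q = 0 := by
  have : (a - c) * (a - e) * (x * L + Q) = 0 := by
    obtain rfl : b = c + e - a := by linear_combination hsum
    linear_combination h' - h
  simpa [sub_eq_zero, hac, hae] using this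

section Vanishing

variable {L Q G : MvPolynomial (Fin 7) ℚ}

lemma line_relation {T : Type*} [CommRing T] [Algebra ℚ T]
    (h126 : φ126 (expansion L Q G) = 0) (h135 : φ135 (expansion L Q G) = 0)
    (h234 : φ234 (expansion L Q G) = 0) (h456 : φ456 (expansion L Q G) = 0) (t : Fin 7 → T)
    {i j k l : Fin 4} (hij : i ≠ j) (hik : i ≠ k) (hil : i ≠ l) (hjk : j ≠ k) (hjl : j ≠ l)
    (hkl : k ≠ l) (hi : t (lineIdx i) = 0) :
    edge t i j * edge t i k * edge t i l * aeval t L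
      + (edge t i j * edge t i k + edge t i j * edge t i l + edge t i k * edge t i l) * aeval t Q
      + aeval t G = 0 := by
  have hexp (c₂ c₃ : T) : aeval (allVars t c₂ c₃) (expansion L Q G) =
      c₃ * aeval t L + c₂ * aeval t Q + aeval t G := by
    simp only [expansion, map_add, map_mul, aeval_allVars_fromCoords]
    simp [allVars]
  have h0 (h : t 0 = 0) := hexp _ _ ▸ aeval_eq_zero_of_φ126
    (x := allVars t (edge t 0 1 * edge t 0 2 + edge t 0 1 * edge t 0 3 + edge t 0 2 * edge t 0 3)
      (edge t 0 1 * edge t 0 2 * edge t 0 3)) h126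
    (by simp [allVars, edge, matching, lineIdx, h]; ring) (by simp [allVars]) (by simp [allVars])
  have h1 (h : t 1 = 0) := hexp _ _ ▸ aeval_eq_zero_of_φ135
    (x := allVars t (edge t 0 1 * edge t 1 2 + edge t 0 1 * edge t 1 3 + edge t 1 2 * edge t 1 3)
      (edge t 0 1 * edge t 1 2 * edge t 1 3)) h135
    (by simp [allVars, edge, matching, lineIdx, h]; ring) (by simp [allVars]) (by simp [allVars])
  have h2 (h : t 2 = 0) := hexp _ _ ▸ aeval_eq_zero_of_φ234
    (x := allVars t (edge t 0 2 * edge t 1 2 + edge t 0 2 * edge t 2 3 + edge t 1 2 * edge t 2 3)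
      (edge t 0 2 * edge t 1 2 * edge t 2 3)) h234
    (by simp [allVars, edge, matching, lineIdx, h]; ring) (by simp [allVars]) (by simp [allVars])
  have h3 (h : t 3 = 0) := hexp _ _ ▸ aeval_eq_zero_of_φ456
    (x := allVars t (edge t 2 3 * edge t 1 3 + edge t 2 3 * edge t 0 3 + edge t 1 3 * edge t 0 3)
      (edge t 2 3 * edge t 1 3 * edge t 0 3)) h456
    (by simp [allVars, edge, matching, lineIdx, h]; ring) (by simp [allVars]) (by simp [allVars])
  have h10 := edge_comm t 1 0
  have h20 := edge_comm t 2 0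
  have h30 := edge_comm t 3 0
  have h21 := edge_comm t 2 1
  have h31 := edge_comm t 3 1
  have h32 := edge_comm t 3 2
  fin_cases i
  on_goal 1 => specialize h0 hi
  on_goal 2 => specialize h1 hi
  on_goal 3 => specialize h2 hi
  on_goal 4 => specialize h3 hi
  all_goals
    fin_cases j <;> fin_cases k <;> fin_cases l <;> simp at hij hik hil hjk hjl hkl <;>
    simp only [Fin.zero_eta, Fin.mk_one, Fin.reduceFinMk, h10, h20, h30, h21, h31, h32]
  all_goals first
    | linear_combination h0
    | linear_combination h1
    | linear_combination h2
    | linear_combination h3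

lemma pair_relation
    (h126 : φ126 (expansion L Q G) = 0) (h135 : φ135 (expansion L Q G) = 0)
    (h234 : φ234 (expansion L Q G) = 0) (h456 : φ456 (expansion L Q G) = 0)
    {T : Type*} [CommRing T] [IsDomain T] [CharZero T] [Algebra ℚ T] {t : Fin 7 → T}
    {i j k l : Fin 4} (hij : i ≠ j) (hik : i ≠ k) (hil : i ≠ l) (hjk : j ≠ k) (hjl : j ≠ l)
    (hkl : k ≠ l) (hi : t (lineIdx i) = 0) (hj : t (lineIdx j) = 0)
    (hm : t (matching i k) ≠ t (matching j k)) (hl : t (lineIdx k) ≠ t (lineIdx l)) :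
    edge t i j * aeval t L + aeval t Q = 0 := by
  have hi' := line_relation h126 h135 h234 h456 t hij hik hil hjk hjl hkl hi
  have hj' := line_relation h126 h135 h234 h456 t hij.symm hjk hjl hik hil hkl hj
  rw [edge_comm t j i] at hj'
  have hm₁ : matching i k = matching j l := matching_eq_opposite hik hij hil hjk.symm hkl hjl
  have hm₂ : matching i l = matching j k := matching_eq_opposite hil hij hik hjl.symm hkl.symm hjk
  refine add_eq_zero_of_two_lines ?_ ?_ ?_ hi' hj'
  · simp only [edge, hi, hj, hm₁, hm₂]
    ring
  · intro h
    refine hm ?_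
    simp only [edge, hi, hj] at h
    linear_combination h
  · intro h
    refine hl (mul_left_cancel₀ (two_ne_zero (α := T)) ?_)
    simp only [edge, hi, hj, hm₁] at h
    linear_combination -h

end Vanishing

lemma sum_eq_of_mem_support {p : MvPolynomial (Fin 7) ℚ} {n : ℕ} (hp : p.IsHomogeneous n)
    {m : Fin 7 →₀ ℕ} (hm : m ∈ p.support) : m 0 + m 1 + m 2 + m 3 + m 4 + m 5 + m 6 = n := by
  rw [← hp (mem_support_iff.1 hm)]
  simp [Finsupp.weight_apply, Finsupp.sum_fintype, Fin.sum_univ_succ]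
  ring

lemma coordPoint_matching {S : Finset (Fin 7)} (hS : ∀ i ∈ S, i < 4) {i j : Fin 4} (hij : i ≠ j) :
    coordPoint S (matching i j) = X (matching i j) := by
  have : ¬ matching i j < 4 := by decide +revert
  exact if_neg fun h => this (hS _ h)

lemma lineIdx_lt (i : Fin 4) : lineIdx i < 4 := by decide +revert

lemma lineIdx_injective : Function.Injective lineIdx := by decide

section Generic

variable {L Q G : MvPolynomial (Fin 7) ℚ}

lemma generic_pair_relation
    (h126 : φ126 (expansion L Q G) = 0) (h135 : φ135 (expansion L Q G) = 0)
    (h234 : φ234 (expansion L Q G) = 0) (h456 : φ456 (expansion L Q G) = 0)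
    {S : Finset (Fin 7)} (hS : ∀ i ∈ S, i < 4) {i j k l : Fin 4} (hij : i ≠ j)
    (hik : i ≠ k) (hil : i ≠ l) (hjk : j ≠ k) (hjl : j ≠ l) (hkl : k ≠ l)
    (hi : lineIdx i ∈ S) (hj : lineIdx j ∈ S) (hl : lineIdx l ∉ S) :
    edge (coordPoint S) i j * aeval (coordPoint S) L + aeval (coordPoint S) Q = 0 := by
  refine pair_relation h126 h135 h234 h456 hij hik hil hjk hjl hkl (if_pos hi) (if_pos hj) ?_ ?_
  · rw [coordPoint_matching hS hik, coordPoint_matching hS hjk, X_injective.ne_iff,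
      matching_comm i, matching_comm j]
    exact matching_ne hik.symm hjk.symm hij
  · by_cases hk : lineIdx k ∈ S
    · simpa [coordPoint, hk, hl] using (X_ne_zero _).symm
    · simpa [coordPoint, hk, hl, X_injective.eq_iff] using lineIdx_injective.ne hkl

lemma aeval_coordPoint_triple_eq_zero
    (h126 : φ126 (expansion L Q G) = 0) (h135 : φ135 (expansion L Q G) = 0)
    (h234 : φ234 (expansion L Q G) = 0) (h456 : φ456 (expansion L Q G) = 0)
    {i j k l : Fin 4} (hij : i ≠ j) (hik : i ≠ k) (hil : i ≠ l) (hjk : j ≠ k)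
    (hjl : j ≠ l) (hkl : k ≠ l) :
    aeval (coordPoint {lineIdx i, lineIdx j, lineIdx k}) L = 0 := by
  have hS : ∀ x ∈ ({lineIdx i, lineIdx j, lineIdx k} : Finset (Fin 7)), x < 4 := by
    simp [lineIdx_lt]
  have hl : lineIdx l ∉ ({lineIdx i, lineIdx j, lineIdx k} : Finset (Fin 7)) := by
    simp [lineIdx_injective.eq_iff, hil.symm, hjl.symm, hkl.symm]
  have hj := generic_pair_relation h126 h135 h234 h456 hS hij hik hil hjk hjl hkl
    (by simp) (by simp) hl
  have hk := generic_pair_relation h126 h135 h234 h456 hS hik hij hil hjk.symm hkl hjl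
    (by simp) (by simp) hl
  have hne : (X (matching i j) : MvPolynomial (Fin 7) ℚ) ≠ X (matching i k) :=
    X_injective.ne (matching_ne hij hik hjk)
  refine (mul_eq_zero.1 ?_).resolve_left (sub_ne_zero.2 hne)
  rw [← coordPoint_matching hS hij, ← coordPoint_matching hS hik]
  have hj0 : coordPoint {lineIdx i, lineIdx j, lineIdx k} (lineIdx j) = 0 := if_pos (by simp)
  have hk0 : coordPoint {lineIdx i, lineIdx j, lineIdx k} (lineIdx k) = 0 := if_pos (by simp)
  simp only [edge, hj0, hk0] at hj hk
  linear_combination hj - hk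

lemma linear_part_eq_zero (hL : L.IsHomogeneous 1)
    (h126 : φ126 (expansion L Q G) = 0) (h135 : φ135 (expansion L Q G) = 0)
    (h234 : φ234 (expansion L Q G) = 0) (h456 : φ456 (expansion L Q G) = 0) : L = 0 := by
  refine support_eq_empty.1 (Finset.eq_empty_of_forall_notMem fun m hm => ?_)
  have hdeg := sum_eq_of_mem_support hL hm
  have hpos {i j k l : Fin 4} (h : i ≠ j ∧ i ≠ k ∧ i ≠ l ∧ j ≠ k ∧ j ≠ l ∧ k ≠ l) :=
    sum_pos_of_aeval_coordPoint_eq_zero (aeval_coordPoint_triple_eq_zero h126 h135 h234 h456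
      h.1 h.2.1 h.2.2.1 h.2.2.2.1 h.2.2.2.2.1 h.2.2.2.2.2) hm
  have h012 := @hpos 0 1 2 3 (by decide)
  have h013 := @hpos 0 1 3 2 (by decide)
  have h023 := @hpos 0 2 3 1 (by decide)
  have h123 := @hpos 1 2 3 0 (by decide)
  simp [lineIdx] at h012 h013 h023 h123
  omega

lemma quadratic_part_eq_zero (hQ : Q.IsHomogeneous 2)
    (h126 : φ126 (expansion 0 Q G) = 0) (h135 : φ135 (expansion 0 Q G) = 0)
    (h234 : φ234 (expansion 0 Q G) = 0) (h456 : φ456 (expansion 0 Q G) = 0) : Q = 0 := by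
  refine support_eq_empty.1 (Finset.eq_empty_of_forall_notMem fun m hm => ?_)
  have hdeg := sum_eq_of_mem_support hQ hm
  have hpos {i j k l : Fin 4} (h : i ≠ j ∧ i ≠ k ∧ i ≠ l ∧ j ≠ k ∧ j ≠ l ∧ k ≠ l) :
      0 < ∑ x ∈ {lineIdx i, lineIdx j}, m x := by
    obtain ⟨hij, hik, hil, hjk, hjl, hkl⟩ := h
    refine sum_pos_of_aeval_coordPoint_eq_zero ?_ hm
    simpa using generic_pair_relation h126 h135 h234 h456 (by simp [lineIdx_lt]) hij hik hil hjk
      hjl hkl (by simp) (by simp) (by simp [lineIdx_injective.eq_iff, hil.symm, hjl.symm])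
  have h01 := @hpos 0 1 2 3 (by decide)
  have h02 := @hpos 0 2 1 3 (by decide)
  have h03 := @hpos 0 3 1 2 (by decide)
  have h12 := @hpos 1 2 0 3 (by decide)
  have h13 := @hpos 1 3 0 2 (by decide)
  have h23 := @hpos 2 3 0 1 (by decide)
  simp [lineIdx] at h01 h02 h03 h12 h13 h23
  omega

lemma quartic_part_eq_monomial (hG : G.IsHomogeneous 4)
    (h126 : φ126 (expansion 0 0 G) = 0) (h135 : φ135 (expansion 0 0 G) = 0)
    (h234 : φ234 (expansion 0 0 G) = 0) (h456 : φ456 (expansion 0 0 G) = 0) :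
    ∃ a, G = C a * (X 0 * X 1 * X 2 * X 3) := by
  let m₀ : Fin 7 →₀ ℕ := Finsupp.equivFunOnFinite.symm ![1, 1, 1, 1, 0, 0, 0]
  have hsupp (m : Fin 7 →₀ ℕ) (hm : m ∈ G.support) : m = m₀ := by
    have hdeg := sum_eq_of_mem_support hG hm
    have hpos {i j k l : Fin 4} (h : i ≠ j ∧ i ≠ k ∧ i ≠ l ∧ j ≠ k ∧ j ≠ l ∧ k ≠ l) :
        0 < ∑ x ∈ {lineIdx i}, m x := by
      obtain ⟨hij, hik, hil, hjk, hjl, hkl⟩ := h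
      refine sum_pos_of_aeval_coordPoint_eq_zero ?_ hm
      simpa using line_relation h126 h135 h234 h456 (coordPoint {lineIdx i}) hij hik hil hjk
        hjl hkl (if_pos (by simp))
    have h0 := @hpos 0 1 2 3 (by decide)
    have h1 := @hpos 1 0 2 3 (by decide)
    have h2 := @hpos 2 0 1 3 (by decide)
    have h3 := @hpos 3 0 1 2 (by decide)
    simp [lineIdx] at h0 h1 h2 h3
    ext k
    fin_cases k <;> simp [m₀] <;> omega
  refine ⟨coeff m₀ G, ?_⟩
  have hmon : (X 0 * X 1 * X 2 * X 3 : MvPolynomial (Fin 7) ℚ) = monomial m₀ 1 := by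
    rw [monomial_eq, Finsupp.prod_fintype _ _ (by simp)]
    simp [Fin.prod_univ_succ, m₀]
    ring
  rw [hmon, C_mul_monomial, mul_one]
  ext m
  rw [coeff_monomial]
  split_ifs with h
  · rw [h]
  · exact notMem_support_iff.1 fun hm => h (hsupp m hm).symm

end Generic

lemma eq_zero_of_coeff_eq_zero {F : MvPolynomial (Fin 9) ℚ}
    (hF : F ∈ weightedHomogeneousSubmodule ℚ wt 4) (hcoeff : coeff (Finsupp.single 1 2) F = 0)
    (h126 : φ126 F = 0) (h135 : φ135 F = 0) (h234 : φ234 F = 0) (h456 : φ456 F = 0)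
    (h124_356 : φ124_356 F = 0) : F = 0 := by
  obtain ⟨L, Q, G, hL, hQ, hG, rfl⟩ := exists_eq_expansion hF hcoeff
  obtain rfl := linear_part_eq_zero hL h126 h135 h234 h456
  obtain rfl := quadratic_part_eq_zero hQ h126 h135 h234 h456
  obtain ⟨a, rfl⟩ := quartic_part_eq_monomial hG h126 h135 h234 h456
  have h := aeval_eq_zero_of_φ124_356 h124_356
  have ha : a = 0 := by
    simpa [expansion, fromCoords] using h
  simp [ha, expansion]

/-- The space of homogeneous degree-4 polynomials in the intersection of the kernels
of the five restriction homomorphisms `φ_{1|2|6}, φ_{1|3|5}, φ_{2|3|4}, φ_{4|5|6}`,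
and `φ_{124|356}` is 1-dimensional over `ℚ`. -/
theorem dim_five_kernels_eq_one :
    Module.finrank ℚ
      ↥(weightedHomogeneousSubmodule ℚ wt 4 ⊓
        LinearMap.ker φ126.toLinearMap ⊓ LinearMap.ker φ135.toLinearMap ⊓
        LinearMap.ker φ234.toLinearMap ⊓ LinearMap.ker φ456.toLinearMap ⊓
        LinearMap.ker φ124_356.toLinearMap) = 1 := by
  have hmem : menelausClass ∈ weightedHomogeneousSubmodule ℚ wt 4 ⊓
      LinearMap.ker φ126.toLinearMap ⊓ LinearMap.ker φ135.toLinearMap ⊓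
      LinearMap.ker φ234.toLinearMap ⊓ LinearMap.ker φ456.toLinearMap ⊓
      LinearMap.ker φ124_356.toLinearMap :=
    ⟨⟨⟨⟨⟨isWeightedHomogeneous_menelausClass, φ126_menelausClass⟩, φ135_menelausClass⟩,
      φ234_menelausClass⟩, φ456_menelausClass⟩, φ124_356_menelausClass⟩
  have hne : menelausClass ≠ 0 := fun h => by
    simpa [h] using coeff_menelausClass
  refine (finrank_eq_one_iff_of_nonzero' ⟨menelausClass, hmem⟩ (by simpa using hne)).2 ?_
  rintro ⟨F, hF⟩
  refine ⟨coeff (Finsupp.single 1 2) F, Subtype.ext (sub_eq_zero.1 ?_)⟩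
  obtain ⟨⟨⟨⟨⟨h, h126⟩, h135⟩, h234⟩, h456⟩, h124_356⟩ :=
    sub_mem (Submodule.smul_mem _ (coeff (Finsupp.single 1 2) F) hmem) hF
  exact eq_zero_of_coeff_eq_zero h (by simp [coeff_menelausClass]) h126 h135 h234 h456 h124_356
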